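/- There is a universal constant C such that, conditioned on the bin structure determined by the first two batches of samples, with probability greater than 3/4 over a fresh independent count matrix C′ with entries C′_{i,j} ~ Poisson(N·B_{i,j}) and B′ = C′/N: ‖P_V · D^{−1}(B′ − B)D^{−1} · P_V‖ ≤ C·R·log²(N)/√(w_min·N) in spectral norm. -/

import Mathlib

open Matrix MeasureTheory ProbabilityTheory Filter
open scoped Classical ENNReal BigOperators

noncomputable section

/-- The spectral (operator `ℓ²→ℓ²`) norm of a real matrix. -/
def specNorm {m n : ℕ} (A : Matrix (Fin m) (Fin n) ℝ) : ℝ :=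
  ‖LinearMap.toContinuousLinearMap (Matrix.toEuclideanLin A)‖

/-- The law of the Poissonized count matrix: the entries `C (i,j)` are mutually independent
with `C (i,j) ~ Poisson(N · B i j)`. -/
def countMeasure (M N : ℕ) (B : Matrix (Fin M) (Fin M) ℝ) :
    Measure ((Fin M × Fin M) → ℕ) :=
  Measure.pi fun p => ProbabilityTheory.poissonMeasure ((N : ℝ) * B p.1 p.2).toNNReal

/-- Empirical marginal probability `ρ̂_i = Σ_j (C_{i,j} + C_{j,i}) / (2N)`. -/
def empMarg (M N : ℕ) (C : (Fin M × Fin M) → ℕ) (i : Fin M) : ℝ :=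
  (∑ j : Fin M, ((C (i, j) : ℝ) + (C (j, i) : ℝ))) / (2 * N)

/-- The `k`-th empirical bin `I_k = {i : e^{k−1}/N ≤ ρ̂_i < e^k/N}` (for `k ≥ 1`). -/
def binSet (M N : ℕ) (C : (Fin M × Fin M) → ℕ) (k : ℕ) : Finset (Fin M) :=
  Finset.univ.filter fun i =>
    Real.exp ((k : ℝ) - 1) / N ≤ empMarg M N C i ∧ empMarg M N C i < Real.exp (k : ℝ) / N

/-- The bin threshold `ρ̄_k = e^{k+1}/N`. -/
def binThresh (N k : ℕ) : ℝ := Real.exp ((k : ℝ) + 1) / N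

/-- The true marginal probability `ρ_i = Σ_j B_{i,j}`. -/
def marg (M : ℕ) (B : Matrix (Fin M) (Fin M) ℝ) (i : Fin M) : ℝ := ∑ j, B i j

/-- The scaled count matrix `(1/N)·C`. -/
def scaledCount (M N : ℕ) (C : (Fin M × Fin M) → ℕ) : Matrix (Fin M) (Fin M) ℝ :=
  Matrix.of fun i j => (C (i, j) : ℝ) / N

/-- The set of words in bin `k` (bins from `Cb`) zeroed out by the regularization step applied
to the counts `Cc`: words whose full row/column sum exceeds `2ρ̄_k`, or whose within-block
row/column sum exceeds `2|I_k|ρ̄_k²/w_min`. -/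
def zeroedSet (M N : ℕ) (wmin : ℝ) (Cb Cc : (Fin M × Fin M) → ℕ) (k : ℕ) : Finset (Fin M) :=
  (binSet M N Cb k).filter fun i =>
    2 * binThresh N k < (∑ j : Fin M, (Cc (i, j) : ℝ)) / N ∨
    2 * binThresh N k < (∑ j : Fin M, (Cc (j, i) : ℝ)) / N ∨
    2 * ((binSet M N Cb k).card : ℝ) * binThresh N k ^ 2 / wmin <
      (∑ j ∈ binSet M N Cb k, (Cc (i, j) : ℝ)) / N ∨
    2 * ((binSet M N Cb k).card : ℝ) * binThresh N k ^ 2 / wmin <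
      (∑ j ∈ binSet M N Cb k, (Cc (j, i) : ℝ)) / N

/-- The regularized `k`-th diagonal block `B̃_k` (embedded as an `M×M` matrix supported on
`I_k × I_k`): the block of `(1/N)·Cc` on bin `I_k` (bins from `Cb`), with the zeroed-out
rows and columns set to `0`. -/
def regBlock (M N : ℕ) (wmin : ℝ) (Cb Cc : (Fin M × Fin M) → ℕ) (k : ℕ) :
    Matrix (Fin M) (Fin M) ℝ :=
  Matrix.of fun i j =>
    if i ∈ binSet M N Cb k ∧ j ∈ binSet M N Cb k ∧
        i ∉ zeroedSet M N wmin Cb Cc k ∧ j ∉ zeroedSet M N wmin Cb Cc k then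
      (Cc (i, j) : ℝ) / N
    else 0

/-- The restriction of a matrix to a block `S × S` (embedded as an `M×M` matrix). -/
def blockOf (M : ℕ) (A : Matrix (Fin M) (Fin M) ℝ) (S : Finset (Fin M)) :
    Matrix (Fin M) (Fin M) ℝ :=
  Matrix.of fun i j => if i ∈ S ∧ j ∈ S then A i j else 0

/-- Bin `k` is retained: `k ≥ kmin` and `|I_k| ≥ 20·e^{−3(k+1)/2}·N`. -/
def Retained (M N : ℕ) (kmin : ℝ) (Cb : (Fin M × Fin M) → ℕ) (k : ℕ) : Prop :=
  kmin ≤ (k : ℝ) ∧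
    20 * Real.exp (-(3 * ((k : ℝ) + 1)) / 2) * N ≤ ((binSet M N Cb k).card : ℝ)

/-- `k₀ = 4·log(c₀·R/(ε·√w_min)) + 16`. -/
def k0def (R : ℕ) (c0 ε wmin : ℝ) : ℝ :=
  4 * Real.log (c0 * R / (ε * Real.sqrt wmin)) + 16

/-- `Q` is a symmetric idempotent (orthogonal projection) matrix supported on `S × S`. -/
def IsProjOn (M : ℕ) (S : Finset (Fin M)) (Q : Matrix (Fin M) (Fin M) ℝ) : Prop :=
  Qᵀ = Q ∧ Q * Q = Q ∧ ∀ i j, (i ∉ S ∨ j ∉ S) → Q i j = 0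

/-- `Pk` is the orthogonal projection onto the span of the top `R` left singular vectors of `A`
(viewed as a block supported on `S`): among all rank-`≤ R` orthogonal projections supported on
`S`, it minimizes `‖A − Q·A‖`. -/
def IsTopRProj (M R : ℕ) (A : Matrix (Fin M) (Fin M) ℝ) (S : Finset (Fin M))
    (Pk : Matrix (Fin M) (Fin M) ℝ) : Prop :=
  IsProjOn M S Pk ∧ Pk.rank ≤ R ∧
    ∀ Q : Matrix (Fin M) (Fin M) ℝ, IsProjOn M S Q → Q.rank ≤ R →
      specNorm (A - Pk * A) ≤ specNorm (A - Q * A)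

/-- The block-diagonal projection `P_V` assembled from per-bin projections over retained bins. -/
def PVmat (M N : ℕ) (kmin : ℝ) (Cb : (Fin M × Fin M) → ℕ)
    (Pk : ℕ → Matrix (Fin M) (Fin M) ℝ) : Matrix (Fin M) (Fin M) ℝ :=
  ∑ k ∈ Finset.Icc 1 (Nat.floor (Real.log N)),
    if Retained M N kmin Cb k then Pk k else 0

/-- The block-diagonal scaling matrix `D` (`√ρ̄_k` on the coordinates of each retained bin,
`0` on discarded coordinates). -/
def Dmat (M N : ℕ) (kmin : ℝ) (Cb : (Fin M × Fin M) → ℕ) : Matrix (Fin M) (Fin M) ℝ :=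
  Matrix.diagonal fun i =>
    ∑ k ∈ Finset.Icc 1 (Nat.floor (Real.log N)),
      if i ∈ binSet M N Cb k ∧ Retained M N kmin Cb k then Real.sqrt (binThresh N k) else 0

/-- The block-diagonal scaling matrix `D^{−1}` (`1/√ρ̄_k` on the coordinates of each retained
bin, `0` on discarded coordinates). -/
def Dinv (M N : ℕ) (kmin : ℝ) (Cb : (Fin M × Fin M) → ℕ) : Matrix (Fin M) (Fin M) ℝ :=
  Matrix.diagonal fun i =>
    ∑ k ∈ Finset.Icc 1 (Nat.floor (Real.log N)),
      if i ∈ binSet M N Cb k ∧ Retained M N kmin Cb k then (Real.sqrt (binThresh N k))⁻¹ else 0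

lemma hasSum_poisson_mul {r : NNReal} {f : ℕ → ℝ} {s : ℝ}
    (h : HasSum (fun n : ℕ => Real.exp (-r) * r ^ n / n.factorial * f (n + 1)) s) :
    HasSum (fun n : ℕ => Real.exp (-r) * r ^ n / n.factorial * (n * f n)) (r * s) := by
  rw [← hasSum_nat_add_iff' 1]
  simp only [Finset.range_one, Finset.sum_singleton, Nat.cast_zero, zero_mul, mul_zero, sub_zero]
  refine (h.mul_left (r : ℝ)).congr_fun ?_
  intro n
  have h1 : (n.factorial : ℝ) ≠ 0 := by positivity
  have h2 : (n : ℝ) + 1 ≠ 0 := by positivity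
  rw [Nat.factorial_succ]
  push_cast
  field_simp
  ring

lemma hasSum_poisson_id (r : NNReal) :
    HasSum (fun n : ℕ => Real.exp (-r) * r ^ n / n.factorial * n) r := by
  have := hasSum_poisson_mul (r := r) (f := fun _ => 1) (s := 1)
    (by simpa using hasSum_one_poissonMeasure r)
  simpa using this

lemma hasSum_poisson_sq (r : NNReal) :
    HasSum (fun n : ℕ => Real.exp (-r) * r ^ n / n.factorial * (n : ℝ) ^ 2) (r * (r + 1)) := by
  have := hasSum_poisson_mul (r := r) (f := fun n => (n : ℝ)) (s := r + 1) (by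
    refine ((hasSum_poisson_id r).add (hasSum_one_poissonMeasure r)).congr_fun ?_
    intro n
    push_cast
    ring)
  simpa [sq] using this

lemma memLp_two_natCast_poissonMeasure (r : NNReal) :
    MemLp (fun n : ℕ => (n : ℝ)) 2 (poissonMeasure r) := by
  rw [memLp_two_iff_integrable_sq .of_discrete, integrable_poissonMeasure_iff]
  simpa using (hasSum_poisson_sq r).summable

lemma integral_natCast_poissonMeasure (r : NNReal) :
    ∫ n : ℕ, (n : ℝ) ∂(poissonMeasure r) = r := by
  rw [integral_poissonMeasure]
  exact (hasSum_poisson_id r).tsum_eq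

lemma variance_natCast_poissonMeasure (r : NNReal) :
    variance (fun n : ℕ => (n : ℝ)) (poissonMeasure r) = r := by
  rw [variance_eq_sub (memLp_two_natCast_poissonMeasure r), integral_natCast_poissonMeasure,
    integral_poissonMeasure]
  have := (hasSum_poisson_sq r).tsum_eq
  simp only [Pi.pow_apply, smul_eq_mul]
  rw [this]
  ring

/-- Second moment of a centred linear form in independent Poisson variables. -/
lemma secondMoment_linear_pi_poisson {ι : Type*} [Fintype ι] (r : ι → NNReal) (c : ι → ℝ) :
    Integrable (fun ω : ι → ℕ => (∑ p, c p * ((ω p : ℝ) - r p)) ^ 2)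
      (Measure.pi fun p => poissonMeasure (r p)) ∧
    ∫ ω : ι → ℕ, (∑ p, c p * ((ω p : ℝ) - r p)) ^ 2 ∂(Measure.pi fun p => poissonMeasure (r p)) =
      ∑ p, c p ^ 2 * r p := by
  set μ := Measure.pi fun p => poissonMeasure (r p) with hμ
  have hX : ∀ p, MemLp (fun n : ℕ => c p * ((n : ℝ) - r p)) 2 (poissonMeasure (r p)) := fun p =>
    ((memLp_two_natCast_poissonMeasure (r p)).sub (memLp_const _)).const_mul _
  have hX' : ∀ p, MemLp (fun ω : ι → ℕ => c p * ((ω p : ℝ) - r p)) 2 μ := fun p =>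
    (hX p).comp_measurePreserving (measurePreserving_eval _ p)
  have hS : MemLp (fun ω : ι → ℕ => ∑ p, c p * ((ω p : ℝ) - r p)) 2 μ :=
    memLp_finsetSum _ fun p _ => hX' p
  refine ⟨hS.integrable_sq, ?_⟩
  have hmean : ∀ p, ∫ ω : ι → ℕ, c p * ((ω p : ℝ) - r p) ∂μ = 0 := by
    intro p
    have h := integral_comp_eval (μ := fun p => poissonMeasure (r p)) (i := p)
      (f := fun n : ℕ => c p * ((n : ℝ) - r p)) .of_discrete
    rw [h, integral_const_mul,
      integral_sub ((memLp_two_natCast_poissonMeasure _).integrable (by norm_num))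
        (integrable_const _), integral_natCast_poissonMeasure]
    simp
  have hzero : ∫ ω : ι → ℕ, ∑ p, c p * ((ω p : ℝ) - r p) ∂μ = 0 := by
    rw [integral_finsetSum _ fun p _ => (hX' p).integrable (by norm_num)]
    exact Finset.sum_eq_zero fun p _ => hmean p
  rw [← variance_of_integral_eq_zero hS.aestronglyMeasurable.aemeasurable hzero]
  have hv := variance_sum_pi hX
  have hfun : (∑ p, fun ω : ι → ℕ => c p * ((ω p : ℝ) - r p)) =
      fun ω : ι → ℕ => ∑ p, c p * ((ω p : ℝ) - r p) := by
    ext ω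
    simp
  rw [hfun] at hv
  rw [hv]
  refine Finset.sum_congr rfl fun p _ => ?_
  rw [variance_const_mul, variance_sub_const .of_discrete, variance_natCast_poissonMeasure]

/-- The spectral norm is at most the Frobenius norm. -/
lemma specNorm_sq_le_sum_sq {m n : ℕ} (A : Matrix (Fin m) (Fin n) ℝ) :
    specNorm A ^ 2 ≤ ∑ i, ∑ j, A i j ^ 2 := by
  have h0 : 0 ≤ ∑ i, ∑ j, A i j ^ 2 :=
    Finset.sum_nonneg fun i _ => Finset.sum_nonneg fun j _ => sq_nonneg _
  have h : specNorm A ≤ Real.sqrt (∑ i, ∑ j, A i j ^ 2) := by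
    refine ContinuousLinearMap.opNorm_le_bound _ (Real.sqrt_nonneg _) fun x => ?_
    rw [EuclideanSpace.norm_eq, EuclideanSpace.norm_eq, ← Real.sqrt_mul h0, Finset.sum_mul]
    refine Real.sqrt_le_sqrt (Finset.sum_le_sum fun i _ => ?_)
    simpa [Matrix.mulVec, dotProduct] using
      Finset.sum_mul_sq_le_sq_mul_sq Finset.univ (fun j => A i j) (fun j => x j)
  calc specNorm A ^ 2 ≤ Real.sqrt (∑ i, ∑ j, A i j ^ 2) ^ 2 :=
        pow_le_pow_left₀ (norm_nonneg _) h 2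
    _ = _ := Real.sq_sqrt h0

/-- The trace of an idempotent matrix is its rank. -/
lemma trace_eq_rank_of_mul_self {n : ℕ} {Q : Matrix (Fin n) (Fin n) ℝ} (h : Q * Q = Q) :
    Q.trace = Q.rank := by
  have hi : IsIdempotentElem (Matrix.toLin' Q) := by
    change Matrix.toLin' Q * Matrix.toLin' Q = Matrix.toLin' Q
    rw [Module.End.mul_eq_comp, ← Matrix.toLin'_mul, h]
  have := LinearMap.IsProj.trace ((LinearMap.isProj_range_iff_isIdempotentElem _).2 hi)
  rw [Matrix.trace_toLin'_eq] at this
  rw [this]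
  rfl

lemma diag_eq_sum_sq {n : ℕ} {Q : Matrix (Fin n) (Fin n) ℝ} (hT : Qᵀ = Q) (h : Q * Q = Q)
    (i : Fin n) : Q i i = ∑ a, Q a i ^ 2 := by
  conv_lhs => rw [← h, Matrix.mul_apply]
  refine Finset.sum_congr rfl fun a _ => ?_
  rw [sq, ← Matrix.transpose_apply Q i a, hT]

lemma marg_nonneg {M : ℕ} {B : Matrix (Fin M) (Fin M) ℝ} (hB : ∀ i j, 0 ≤ B i j) (i : Fin M) :
    0 ≤ marg M B i := Finset.sum_nonneg fun j _ => hB i j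

lemma empMarg_mem_bin_unique {M N : ℕ} (hN : 0 < N) {C : (Fin M × Fin M) → ℕ} {k l : ℕ}
    {i : Fin M} (hk : i ∈ binSet M N C k) (hl : i ∈ binSet M N C l) : k = l := by
  have hN' : (0 : ℝ) < N := by exact_mod_cast hN
  have key : ∀ a b : ℕ, i ∈ binSet M N C a → i ∈ binSet M N C b → a ≤ b := by
    intro a b ha hb
    have h1 := (Finset.mem_filter.1 ha).2.1
    have h2 := (Finset.mem_filter.1 hb).2.2
    have h3 := (div_lt_div_iff_of_pos_right hN').1 (h1.trans_lt h2)
    have h4 : (a : ℝ) < b + 1 := by linarith [Real.exp_lt_exp.1 h3]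
    exact Nat.lt_succ_iff.1 (by exact_mod_cast h4)
  exact le_antisymm (key k l hk hl) (key l k hl hk)

/-- Frobenius second moment of the Poisson noise, weighted by `d` and projected by `Q`. -/
lemma secondMoment_proj_noise {M N : ℕ} (hN : 0 < N) {B Q : Matrix (Fin M) (Fin M) ℝ}
    (hB : ∀ i j, 0 ≤ B i j) (hT : Qᵀ = Q) (hQ : Q * Q = Q) (d : Fin M → ℝ) :
    Integrable (fun C => ∑ a, ∑ b, (Q * Matrix.diagonal d * (scaledCount M N C - B) *
        Matrix.diagonal d * Q) a b ^ 2) (countMeasure M N B) ∧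
    ∫ C, ∑ a, ∑ b, (Q * Matrix.diagonal d * (scaledCount M N C - B) *
        Matrix.diagonal d * Q) a b ^ 2 ∂(countMeasure M N B) =
      ∑ i, ∑ j, Q i i * Q j j * (d i ^ 2 * d j ^ 2 * B i j / N) := by
  have hN' : (0 : ℝ) < N := by exact_mod_cast hN
  set r : Fin M × Fin M → NNReal := fun p => ((N : ℝ) * B p.1 p.2).toNNReal with hr
  have hrc : ∀ p, (r p : ℝ) = N * B p.1 p.2 := fun p =>
    Real.coe_toNNReal _ (mul_nonneg hN'.le (hB _ _))
  have hentry : ∀ (C : Fin M × Fin M → ℕ) (a b : Fin M),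
      (Q * Matrix.diagonal d * (scaledCount M N C - B) * Matrix.diagonal d * Q) a b =
        ∑ p : Fin M × Fin M, (Q a p.1 * d p.1 * (d p.2 * Q p.2 b) / N) * ((C p : ℝ) - r p) := by
    intro C a b
    rw [Fintype.sum_prod_type_right, Matrix.mul_apply]
    refine Finset.sum_congr rfl fun j _ => ?_
    rw [Matrix.mul_diagonal, Matrix.mul_apply, Finset.sum_mul, Finset.sum_mul]
    refine Finset.sum_congr rfl fun i _ => ?_
    rw [Matrix.mul_diagonal, hrc]
    simp only [scaledCount, Matrix.sub_apply, Matrix.of_apply]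
    field_simp
  have hm := fun a b => secondMoment_linear_pi_poisson r
    (fun p : Fin M × Fin M => Q a p.1 * d p.1 * (d p.2 * Q p.2 b) / N)
  simp only [hentry]
  change Integrable _ (Measure.pi fun p => poissonMeasure (r p)) ∧
    ∫ _, _ ∂(Measure.pi fun p => poissonMeasure (r p)) = _
  refine ⟨integrable_finsetSum _ fun a _ => integrable_finsetSum _ fun b _ => (hm a b).1, ?_⟩
  rw [integral_finsetSum _ fun a _ => integrable_finsetSum _ fun b _ => (hm a b).1]
  simp_rw [integral_finsetSum _ fun b _ => (hm _ b).1, fun a b => (hm a b).2,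
    Fintype.sum_prod_type, hrc]
  have hcomm : ∀ f : Fin M → Fin M → Fin M → Fin M → ℝ,
      ∑ a, ∑ b, ∑ i, ∑ j, f a b i j = ∑ i, ∑ j, ∑ a, ∑ b, f a b i j := by
    intro f
    calc _ = ∑ a, ∑ i, ∑ b, ∑ j, f a b i j :=
          Finset.sum_congr rfl fun a _ => Finset.sum_comm
      _ = ∑ i, ∑ a, ∑ j, ∑ b, f a b i j := by
          rw [Finset.sum_comm]
          exact Finset.sum_congr rfl fun i _ => Finset.sum_congr rfl fun a _ => Finset.sum_comm
      _ = _ := Finset.sum_congr rfl fun i _ => Finset.sum_comm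
  rw [hcomm]
  refine Finset.sum_congr rfl fun i _ => Finset.sum_congr rfl fun j _ => ?_
  have hsymm : ∀ a b, Q a b = Q b a := fun a b => by
    conv_lhs => rw [← hT]
    rfl
  rw [diag_eq_sum_sq hT hQ i, diag_eq_sum_sq hT hQ j, Finset.sum_mul_sum, Finset.sum_mul]
  refine Finset.sum_congr rfl fun a _ => ?_
  rw [Finset.sum_mul]
  refine Finset.sum_congr rfl fun b _ => ?_
  rw [hsymm j b]
  field_simp

/-- `P_V` is an orthogonal projection of trace at most `R · log N`. -/
lemma PVmat_isProj {M R N : ℕ} (hN : 0 < N) {kmin : ℝ} {Cb : (Fin M × Fin M) → ℕ}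
    {Pk : ℕ → Matrix (Fin M) (Fin M) ℝ}
    (hPk : ∀ k ∈ Finset.Icc 1 (Nat.floor (Real.log N)), Retained M N kmin Cb k →
      IsProjOn M (binSet M N Cb k) (Pk k) ∧ (Pk k).rank ≤ R) :
    (PVmat M N kmin Cb Pk)ᵀ = PVmat M N kmin Cb Pk ∧
    PVmat M N kmin Cb Pk * PVmat M N kmin Cb Pk = PVmat M N kmin Cb Pk ∧
    (PVmat M N kmin Cb Pk).trace ≤ Nat.floor (Real.log N) * R := by
  unfold PVmat
  refine ⟨?_, ?_, ?_⟩
  · rw [Matrix.transpose_sum]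
    refine Finset.sum_congr rfl fun k hk => ?_
    split_ifs with h
    · exact (hPk k hk h).1.1
    · exact Matrix.transpose_zero
  · rw [Finset.sum_mul]
    refine Finset.sum_congr rfl fun k hk => ?_
    rw [Finset.mul_sum, Finset.sum_eq_single_of_mem k hk]
    · split_ifs with h
      · exact (hPk k hk h).1.2.1
      · exact zero_mul _
    · intro l hl hlk
      split_ifs with h h'
      · ext i j
        rw [Matrix.mul_apply]
        refine Finset.sum_eq_zero fun a _ => ?_
        by_cases ha : a ∈ binSet M N Cb k
        · have hal : a ∉ binSet M N Cb l := fun hc => hlk (empMarg_mem_bin_unique hN hc ha)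
          rw [(hPk l hl h').1.2.2 a j (Or.inl hal), mul_zero]
        · rw [(hPk k hk h).1.2.2 i a (Or.inr ha), zero_mul]
      all_goals simp
  · rw [Matrix.trace_sum]
    calc _ ≤ ∑ k ∈ Finset.Icc 1 (Nat.floor (Real.log N)), (R : ℝ) := by
          refine Finset.sum_le_sum fun k hk => ?_
          split_ifs with h
          · rw [trace_eq_rank_of_mul_self (hPk k hk h).1.2.1]
            exact_mod_cast (hPk k hk h).2
          · simp
      _ = _ := by simp

/-- Under the binning assumption, rescaling by `D^{−1}` keeps marginals below `e · log N`. -/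
lemma Dinv_sq_mul_marg_le {M N : ℕ} (hN : 0 < N) (hlog : 1 ≤ Real.log N) (kmin : ℝ)
    {Cb : (Fin M × Fin M) → ℕ} {B : Matrix (Fin M) (Fin M) ℝ}
    (hbin : ∀ (i : Fin M) (k : ℕ), 1 ≤ k → i ∈ binSet M N Cb k →
      4 * Real.log N / N ≤ marg M B i → marg M B i / Real.exp 1 ≤ binThresh N k) (i : Fin M) :
    (∑ k ∈ Finset.Icc 1 (Nat.floor (Real.log N)),
      if i ∈ binSet M N Cb k ∧ Retained M N kmin Cb k then (Real.sqrt (binThresh N k))⁻¹ else 0) ^ 2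
      * marg M B i ≤ Real.exp 1 * Real.log N := by
  have hN' : (0 : ℝ) < N := by exact_mod_cast hN
  by_cases hex : ∃ k ∈ Finset.Icc 1 (Nat.floor (Real.log N)),
      i ∈ binSet M N Cb k ∧ Retained M N kmin Cb k
  · obtain ⟨k, hk, hik⟩ := hex
    rw [Finset.sum_eq_single_of_mem k hk fun l _ hlk =>
      if_neg fun hc => hlk (empMarg_mem_bin_unique hN hc.1 hik.1), if_pos hik]
    have hk1 := (Finset.mem_Icc.1 hk).1
    have hpos : 0 < binThresh N k := div_pos (Real.exp_pos _) hN'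
    rw [inv_pow, Real.sq_sqrt hpos.le, inv_mul_le_iff₀ hpos]
    by_cases hbig : 4 * Real.log N / N ≤ marg M B i
    · have h := hbin i k hk1 hik.1 hbig
      rw [div_le_iff₀ (Real.exp_pos 1)] at h
      refine h.trans ?_
      have : 0 ≤ binThresh N k * Real.exp 1 := by positivity
      nlinarith
    · refine (not_le.1 hbig).le.trans ?_
      have h2 : (4 : ℝ) ≤ Real.exp ((k : ℝ) + 1) * Real.exp 1 := by
        rw [← Real.exp_add]
        have hk1' : (1 : ℝ) ≤ k := by exact_mod_cast hk1
        linarith [Real.add_one_le_exp ((k : ℝ) + 1 + 1)]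
      rw [binThresh, div_mul_eq_mul_div, ← mul_assoc]
      gcongr
  · rw [Finset.sum_eq_zero fun k hk => if_neg fun hc => hex ⟨k, hk, hc⟩]
    have := Real.exp_pos 1
    simp
    positivity

lemma mul_mul_transpose_nonneg {M R : ℕ} {P : Matrix (Fin M) (Fin R) ℝ}
    {W : Matrix (Fin R) (Fin R) ℝ} (hP : ∀ i r, 0 ≤ P i r) (hW : ∀ s t, 0 ≤ W s t)
    (i j : Fin M) : 0 ≤ (P * W * Pᵀ) i j := by
  simp only [Matrix.mul_apply, Matrix.transpose_apply]
  exact Finset.sum_nonneg fun t _ => mul_nonneg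
    (Finset.sum_nonneg fun s _ => mul_nonneg (hP i s) (hW s t)) (hP j t)

lemma marg_mul_mul_transpose {M R : ℕ} {P : Matrix (Fin M) (Fin R) ℝ}
    {W : Matrix (Fin R) (Fin R) ℝ} (hP1 : ∀ r, ∑ i, P i r = 1) (i : Fin M) :
    marg M (P * W * Pᵀ) i = ∑ t, (P * W) i t := by
  unfold marg
  simp only [Matrix.mul_apply (M := P * W), Matrix.transpose_apply]
  rw [Finset.sum_comm]
  exact Finset.sum_congr rfl fun t _ => by rw [← Finset.mul_sum, hP1, mul_one]

/-- Each entry of `P W Pᵀ` is at most `ρ_i ρ_j / w_min`. -/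
lemma entry_le_marg_mul_marg {M R : ℕ} {wmin : ℝ} {P : Matrix (Fin M) (Fin R) ℝ}
    {W : Matrix (Fin R) (Fin R) ℝ} (hw : 0 < wmin) (hP : ∀ i r, 0 ≤ P i r)
    (hP1 : ∀ r, ∑ i, P i r = 1) (hW : ∀ s t, 0 ≤ W s t) (hWr : ∀ s, wmin ≤ ∑ t, W s t)
    (i j : Fin M) :
    (P * W * Pᵀ) i j ≤ marg M (P * W * Pᵀ) i * marg M (P * W * Pᵀ) j / wmin := by
  have hPj : ∀ t, P j t ≤ marg M (P * W * Pᵀ) j / wmin := by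
    intro t
    rw [le_div_iff₀ hw, marg_mul_mul_transpose hP1]
    simp only [Matrix.mul_apply]
    rw [Finset.sum_comm]
    calc P j t * wmin ≤ P j t * ∑ u, W t u := by gcongr; exacts [hP j t, hWr t]
      _ = ∑ u, P j t * W t u := Finset.mul_sum _ _ _
      _ ≤ _ := Finset.single_le_sum (f := fun s => ∑ u, P j s * W s u)
          (fun s _ => Finset.sum_nonneg fun u _ => mul_nonneg (hP j s) (hW s u))
          (Finset.mem_univ t)
  rw [mul_div_assoc]
  conv_rhs => rw [marg_mul_mul_transpose hP1 i, Finset.sum_mul]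
  rw [Matrix.mul_apply]
  refine Finset.sum_le_sum fun t _ => mul_le_mul_of_nonneg_left (hPj t) ?_
  rw [Matrix.mul_apply]
  exact Finset.sum_nonneg fun s _ => mul_nonneg (hP i s) (hW s t)

lemma lt_measure_of_integral_le {Ω : Type*} [MeasurableSpace Ω] {μ : Measure Ω}
    [IsProbabilityMeasure μ] {F : Ω → ℝ} {G : Set Ω} {T : ℝ} (hT : 0 < T)
    (hF0 : ∀ ω, 0 ≤ F ω) (hF : Integrable F μ) (hI : ∫ ω, F ω ∂μ < T / 4)
    (hG : ∀ ω, F ω ≤ T → ω ∈ G) : ENNReal.ofReal (3 / 4) < μ G := by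
  have h1 := mul_meas_ge_le_integral_of_nonneg (ae_of_all μ hF0) hF T
  have h2 : μ.real {ω | T ≤ F ω} < 1 / 4 := by
    by_contra! h
    nlinarith
  have h3 : (1 : ℝ) ≤ μ.real G + μ.real {ω | T ≤ F ω} := by
    rw [← probReal_univ (μ := μ)]
    refine (measureReal_mono ?_).trans (measureReal_union_le _ _)
    intro ω _
    rcases le_total (F ω) T with h | h
    exacts [Or.inl (hG ω h), Or.inr h]
  rw [ENNReal.ofReal_lt_iff_lt_toReal (by norm_num) (measure_ne_top μ G)]
  change 3 / 4 < μ.real G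
  linarith

/-- projection reduces noise.  Conditioned on the bin structure determined by the
first batch `C₁` (assuming, as holds w.h.p., that no word `i` with `ρ_i ≥ 4log(N)/N` lies in a
bin with `ρ̄_k < ρ_i/e`) and on the projections `P_{V_k}` obtained from the regularized blocks
of a second batch `C₂`, with probability greater than `3/4` over a fresh count matrix `C₃`:
`‖P_V·D^{−1}(B′ − B)D^{−1}·P_V‖ ≤ C·R·log²(N)/√(w_min·N)` where `B′ = C₃/N`. -/
theorem stmt8 :
    ∃ C : ℝ, 0 < C ∧
      ∃ c0 : ℝ, 0 < c0 ∧
        ∀ (M R N : ℕ) (ε wmin : ℝ)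
          (P : Matrix (Fin M) (Fin R) ℝ) (W : Matrix (Fin R) (Fin R) ℝ),
          0 < ε → 0 < wmin → M ≤ N →
          (∀ i r, 0 ≤ P i r) → (∀ r, ∑ i, P i r = 1) →
          W.PosSemidef → (∀ s t, 0 ≤ W s t) → (∑ s, ∑ t, W s t) = 1 →
          (∀ s, wmin ≤ ∑ t, W s t) →
          ∀ C₁ : (Fin M × Fin M) → ℕ,
            (∀ (i : Fin M) (k : ℕ), 1 ≤ k → i ∈ binSet M N C₁ k →
              4 * Real.log N / N ≤ marg M (P * W * Pᵀ) i →
              marg M (P * W * Pᵀ) i / Real.exp 1 ≤ binThresh N k) →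
            ∀ (C₂ : (Fin M × Fin M) → ℕ) (Pk : ℕ → Matrix (Fin M) (Fin M) ℝ),
              (∀ k ∈ Finset.Icc 1 (Nat.floor (Real.log N)),
                Retained M N (k0def R c0 ε wmin) C₁ k →
                IsTopRProj M R (regBlock M N wmin C₁ C₂ k) (binSet M N C₁ k) (Pk k)) →
              ENNReal.ofReal (3 / 4) <
                countMeasure M N (P * W * Pᵀ)
                  {C₃ | specNorm
                      (PVmat M N (k0def R c0 ε wmin) C₁ Pk *
                        Dinv M N (k0def R c0 ε wmin) C₁ *
                        (scaledCount M N C₃ - P * W * Pᵀ) *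
                        Dinv M N (k0def R c0 ε wmin) C₁ *
                        PVmat M N (k0def R c0 ε wmin) C₁ Pk) ≤
                    C * R * Real.log N ^ 2 / Real.sqrt (wmin * N)} := by
  refine ⟨10, by norm_num, 1, one_pos, ?_⟩
  intro M R N ε wmin P W _ hw hMN hP hP1 _ hW hW1 hWr C₁ hbin C₂ Pk hPk
  generalize k0def R 1 ε wmin = kmin at *
  have hprob : IsProbabilityMeasure (countMeasure M N (P * W * Pᵀ)) := by
    unfold countMeasure
    infer_instance
  by_cases hlog : Real.log N < 1
  · have hV : PVmat M N kmin C₁ Pk = 0 := by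
      rw [PVmat, Nat.floor_eq_zero.2 hlog]
      simp
    have hz : specNorm (0 : Matrix (Fin M) (Fin M) ℝ) = 0 := by simp [specNorm]
    have hnn : 0 ≤ 10 * (R : ℝ) * Real.log N ^ 2 / Real.sqrt (wmin * N) := by positivity
    simp only [hV, Matrix.mul_zero, hz, hnn, Set.ofPred_true, measure_univ]
    rw [ENNReal.ofReal_lt_one]
    norm_num
  push Not at hlog
  have hN : 0 < N := by
    rcases Nat.eq_zero_or_pos N with h | h
    · subst h
      norm_num at hlog
    · exact h
  have hN' : (0 : ℝ) < N := by exact_mod_cast hN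
  have hR : 0 < R := by
    rcases Nat.eq_zero_or_pos R with h | h
    · subst h
      simp at hW1
    · exact h
  have hR' : (0 : ℝ) < R := by exact_mod_cast hR
  obtain ⟨hVT, hVV, hVtr⟩ := PVmat_isProj (R := R) hN fun k hk hr =>
    ⟨(hPk k hk hr).1, (hPk k hk hr).2.1⟩
  set Q := PVmat M N kmin C₁ Pk
  set B := P * W * Pᵀ with hBdef
  have hB : ∀ i j, 0 ≤ B i j := mul_mul_transpose_nonneg hP hW
  set d : Fin M → ℝ := fun i => ∑ k ∈ Finset.Icc 1 (Nat.floor (Real.log N)),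
    if i ∈ binSet M N C₁ k ∧ Retained M N kmin C₁ k then (Real.sqrt (binThresh N k))⁻¹ else 0
  have hd : ∀ i, d i ^ 2 * marg M B i ≤ Real.exp 1 * Real.log N :=
    Dinv_sq_mul_marg_le hN hlog kmin hbin
  have hD : Dinv M N kmin C₁ = Matrix.diagonal d := rfl
  rw [hD]
  obtain ⟨hint, hval⟩ := secondMoment_proj_noise hN hB hVT hVV d
  have hQ0 : ∀ i, 0 ≤ Q i i := fun i => by
    rw [diag_eq_sum_sq hVT hVV]
    exact Finset.sum_nonneg fun a _ => sq_nonneg _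
  have hL : 0 < Real.log N := by linarith
  set L := Real.log N with hLdef
  set v := (Real.exp 1 * L) ^ 2 / (wmin * N) with hv
  have hvar : ∀ i j, d i ^ 2 * d j ^ 2 * B i j / N ≤ v := by
    intro i j
    have h1 : d i ^ 2 * d j ^ 2 * B i j ≤
        d i ^ 2 * d j ^ 2 * (marg M B i * marg M B j / wmin) :=
      mul_le_mul_of_nonneg_left (entry_le_marg_mul_marg hw hP hP1 hW hWr i j) (by positivity)
    have h2 : (d i ^ 2 * marg M B i) * (d j ^ 2 * marg M B j) ≤ (Real.exp 1 * L) ^ 2 := by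
      rw [sq (Real.exp 1 * L)]
      exact mul_le_mul (hd i) (hd j) (mul_nonneg (sq_nonneg _) (marg_nonneg hB j)) (by positivity)
    calc _ ≤ d i ^ 2 * d j ^ 2 * (marg M B i * marg M B j / wmin) / N := by gcongr
      _ = (d i ^ 2 * marg M B i) * (d j ^ 2 * marg M B j) / (wmin * N) := by field_simp
      _ ≤ _ := by rw [hv]; gcongr
  have htr : Q.trace ≤ L * R := hVtr.trans (by gcongr; exact Nat.floor_le hL.le)
  have htr0 : 0 ≤ Q.trace := Finset.sum_nonneg fun i _ => hQ0 i
  have hsum : ∑ i, ∑ j, Q i i * Q j j * (d i ^ 2 * d j ^ 2 * B i j / N) ≤ (L * R) ^ 2 * v := by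
    calc _ ≤ ∑ i, ∑ j, Q i i * Q j j * v :=
          Finset.sum_le_sum fun i _ => Finset.sum_le_sum fun j _ =>
            mul_le_mul_of_nonneg_left (hvar i j) (mul_nonneg (hQ0 i) (hQ0 j))
      _ = Q.trace ^ 2 * v := by
          simp only [← Finset.sum_mul, ← Finset.mul_sum, sq, Matrix.trace, Matrix.diag]
      _ ≤ _ := by gcongr
  set T := 10 * (R : ℝ) * L ^ 2 / Real.sqrt (wmin * N) with hT
  have hwN : 0 < wmin * N := by positivity
  have hTpos : 0 < T := by
    have := Real.sqrt_pos.2 hwN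
    positivity
  have hTsq : T ^ 2 = 100 * R ^ 2 * L ^ 4 / (wmin * N) := by
    rw [hT, div_pow, Real.sq_sqrt hwN.le]
    ring
  refine lt_measure_of_integral_le (pow_pos hTpos 2)
    (fun C => Finset.sum_nonneg fun a _ => Finset.sum_nonneg fun b _ => sq_nonneg _) hint ?_ ?_
  · rw [hval]
    refine hsum.trans_lt ?_
    have he : Real.exp 1 ^ 2 < 25 := by
      nlinarith [Real.exp_one_lt_d9, Real.exp_pos 1]
    have hX : 0 < R ^ 2 * L ^ 4 / (wmin * N) := by positivity
    calc (L * R) ^ 2 * v = Real.exp 1 ^ 2 * (R ^ 2 * L ^ 4 / (wmin * N)) := by rw [hv]; ring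
      _ < 25 * (R ^ 2 * L ^ 4 / (wmin * N)) := by gcongr
      _ = T ^ 2 / 4 := by rw [hTsq]; ring
  · intro C hC
    exact le_of_sq_le_sq ((specNorm_sq_le_sum_sq _).trans hC) hTpos.le
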